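/- Let (R, m) be a commutative Noetherian local Cohen–Macaulay ring, q an ideal of R generated by a system of parameters, and t = ℓ(R/q). Let M be a finitely generated maximal Cohen–Macaulay R-module such that M_P is a free R_P-module of constant rank r for every associated prime P of R. Then μ(M) ≤ r·t. -/

import Mathlib

open Pointwise

/-- The length `ℓ(M)` of an `R`-module `M` (possibly infinite), defined as the supremum of the
lengths of strictly increasing chains of submodules of `M`. -/
noncomputable def moduleLength (R M : Type*) [CommRing R] [AddCommGroup M] [Module R M] : ℕ∞ :=
  ⨆ s : LTSeries (Submodule R M), (s.length : ℕ∞)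

/-- The depth of a module `M` over a local ring `(R, m)`: the supremum of the lengths of
(weakly) regular sequences on `M` consisting of elements of `m`. -/
noncomputable def moduleDepth (R M : Type*) [CommRing R] [IsLocalRing R]
    [AddCommGroup M] [Module R M] : ℕ∞ :=
  sSup {n : ℕ∞ | ∃ rs : List R, (∀ r ∈ rs, r ∈ IsLocalRing.maximalIdeal R) ∧
    RingTheory.Sequence.IsWeaklyRegular M rs ∧ (rs.length : ℕ∞) = n}

universe u v

section MultiplicitySymbol

variable {R : Type u} [CommRing R]

/-- Northcott's multiplicity symbol `e(x₁, …, xₙ | N)`. -/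
noncomputable def multiplicitySymbol : List R → (N : Type v) → [AddCommGroup N] →
    [Module R N] → ℤ
  | [], N, _, _ => ((Module.length R N).toNat : ℤ)
  | x :: xs, N, _, _ =>
    multiplicitySymbol xs (QuotSMulTop x N) - multiplicitySymbol xs (Submodule.torsionBy R N x)

lemma multiplicitySymbol_of_subsingleton (xs : List R) (N : Type v) [AddCommGroup N] [Module R N]
    [Subsingleton N] : multiplicitySymbol xs N = 0 := by
  induction xs generalizing N with
  | nil => simp [multiplicitySymbol]
  | cons x xs ih =>
    have : Subsingleton (QuotSMulTop x N) := (Submodule.mkQ_surjective _).subsingleton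
    rw [multiplicitySymbol, ih, ih, sub_zero]

open Function Submodule in
/-- The six-term exact sequence relating multiplication by `x` on a short exact sequence. -/
lemma exists_quotSMulTop_torsionBy_exact {N₁ N₂ N₃ : Type v} [AddCommGroup N₁] [Module R N₁]
    [AddCommGroup N₂] [Module R N₂] [AddCommGroup N₃] [Module R N₃] (x : R)
    (f : N₁ →ₗ[R] N₂) (g : N₂ →ₗ[R] N₃) (hf : Injective f) (hg : Surjective g)
    (hfg : Exact f g) :
    ∃ (k₁ : torsionBy R N₁ x →ₗ[R] torsionBy R N₂ x)
      (k₂ : torsionBy R N₂ x →ₗ[R] torsionBy R N₃ x)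
      (δ : torsionBy R N₃ x →ₗ[R] QuotSMulTop x N₁)
      (c₁ : QuotSMulTop x N₁ →ₗ[R] QuotSMulTop x N₂)
      (c₂ : QuotSMulTop x N₂ →ₗ[R] QuotSMulTop x N₃),
      Injective k₁ ∧ Exact k₁ k₂ ∧ Exact k₂ δ ∧ Exact δ c₁ ∧ Exact c₁ c₂ ∧ Surjective c₂ := by
  have hι (N : Type v) [AddCommGroup N] [Module R N] :
      Exact (torsionBy R N x).subtype (LinearMap.lsmul R N x) := by
    intro y; simp
  have hπ (N : Type v) [AddCommGroup N] [Module R N] :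
      Exact (LinearMap.lsmul R N x) (x • (⊤ : Submodule R N)).mkQ := by
    intro y
    rw [mkQ_apply, Quotient.mk_eq_zero, mem_smul_pointwise_iff_exists]
    simp
  have h₁ : f ∘ₗ LinearMap.lsmul R N₁ x = LinearMap.lsmul R N₂ x ∘ₗ f := by ext; simp
  have h₂ : g ∘ₗ LinearMap.lsmul R N₂ x = LinearMap.lsmul R N₃ x ∘ₗ g := by ext; simp
  let k₁ : torsionBy R N₁ x →ₗ[R] torsionBy R N₂ x :=
    f.restrict fun y hy ↦ by
      rw [mem_torsionBy_iff] at hy ⊢; rw [← map_smul, hy, map_zero]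
  let k₂ : torsionBy R N₂ x →ₗ[R] torsionBy R N₃ x :=
    g.restrict fun y hy ↦ by
      rw [mem_torsionBy_iff] at hy ⊢; rw [← map_smul, hy, map_zero]
  refine ⟨k₁, k₂, SnakeLemma.δ' _ _ _ f g hfg f g hfg h₁ h₂ _ (hι N₃) _ (hπ N₁) hg hf,
    QuotSMulTop.map x f, QuotSMulTop.map x g, ?_, ?_, ?_, ?_, ?_, ?_⟩
  · intro a b hab
    exact Subtype.ext (hf (congrArg Subtype.val hab))
  · rintro ⟨y, hy⟩
    constructor
    · intro h
      obtain ⟨z, rfl⟩ := (hfg y).mp (congrArg Subtype.val h)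
      refine ⟨⟨z, ?_⟩, rfl⟩
      rw [mem_torsionBy_iff] at hy ⊢
      exact hf (by rw [map_smul, hy, map_zero])
    · rintro ⟨z, hz⟩
      rw [← hz]
      exact Subtype.ext (hfg.apply_apply_eq_zero z.1)
  · exact SnakeLemma.exact_δ'_right _ _ _ _ _ _ _ _ _ _ _ _ (hι N₂) _ _ _ _ hg hf k₂ rfl
      (subtype_injective _)
  · exact SnakeLemma.exact_δ'_left _ _ _ _ _ _ _ _ _ _ _ _ _ _ _ _ (hπ N₂) hg hf
      (QuotSMulTop.map x f) (QuotSMulTop.map_comp_mkQ x f) (mkQ_surjective _)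
  · exact QuotSMulTop.map_exact x hfg hg
  · exact QuotSMulTop.map_surjective x hg

/-- The list `xs` generates, together with the annihilator of `N`, an ideal whose radical
contains the maximal ideal. -/
def IsMultiplicitySystem (R : Type u) [CommRing R] [IsLocalRing R] (xs : List R) (N : Type v)
    [AddCommGroup N] [Module R N] : Prop :=
  IsLocalRing.maximalIdeal R ≤ (Module.annihilator R N ⊔ Ideal.ofList xs).radical

variable [IsLocalRing R]

namespace IsMultiplicitySystem

variable {N N' : Type v} [AddCommGroup N] [Module R N] [AddCommGroup N'] [Module R N']
  {x : R} {xs : List R}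

lemma of_annihilator_le (h : IsMultiplicitySystem R xs N)
    (hle : Module.annihilator R N ≤ Module.annihilator R N') : IsMultiplicitySystem R xs N' :=
  h.trans (Ideal.radical_mono (sup_le_sup_right hle _))

lemma of_injective (h : IsMultiplicitySystem R xs N) (f : N' →ₗ[R] N)
    (hf : Function.Injective f) : IsMultiplicitySystem R xs N' :=
  h.of_annihilator_le (f.annihilator_le_of_injective hf)

lemma of_surjective (h : IsMultiplicitySystem R xs N) (f : N →ₗ[R] N')
    (hf : Function.Surjective f) : IsMultiplicitySystem R xs N' :=
  h.of_annihilator_le (f.annihilator_le_of_surjective hf)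

lemma of_cons (h : IsMultiplicitySystem R (x :: xs) N)
    (hle : Module.annihilator R N ≤ Module.annihilator R N')
    (hx : x ∈ Module.annihilator R N') : IsMultiplicitySystem R xs N' := by
  refine h.trans (Ideal.radical_mono ?_)
  rw [Ideal.ofList_cons, ← sup_assoc]
  refine sup_le_sup_right (sup_le hle ?_) _
  rwa [Ideal.span_singleton_le_iff_mem]

lemma quotSMulTop (h : IsMultiplicitySystem R (x :: xs) N) :
    IsMultiplicitySystem R xs (QuotSMulTop x N) :=
  h.of_cons (LinearMap.annihilator_le_of_surjective _ (Submodule.mkQ_surjective _))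
    (QuotSMulTop.mem_annihilator _ x)

lemma torsionBy (h : IsMultiplicitySystem R (x :: xs) N) :
    IsMultiplicitySystem R xs (Submodule.torsionBy R N x) := by
  refine h.of_cons (LinearMap.annihilator_le_of_injective _
    (Submodule.subtype_injective (Submodule.torsionBy R N x))) ?_
  rw [Module.mem_annihilator]
  intro m
  ext
  simp

lemma length_ne_top [IsNoetherianRing R] [Module.Finite R N]
    (h : IsMultiplicitySystem R [] N) : Module.length R N ≠ ⊤ := by
  nontriviality N
  rw [IsMultiplicitySystem, Ideal.ofList_nil, sup_bot_eq] at h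
  let I := Module.annihilator R N
  have hI : I ≠ ⊤ := fun h ↦ not_subsingleton N (Module.annihilator_eq_top_iff.mp h)
  have : IsArtinianRing (R ⧸ I) :=
    IsLocalRing.quotient_artinian_of_mem_minimalPrimes_of_isLocalRing I
      ⟨⟨inferInstance, IsLocalRing.le_maximalIdeal hI⟩,
        fun _ hp _ ↦ h.trans (hp.1.radical_le_iff.mpr hp.2)⟩
  let : Module (R ⧸ I) N := Module.quotientAnnihilator
  have : Module.Finite (R ⧸ I) N := Module.Finite.of_restrictScalars_finite R _ _
  rw [Module.length_eq_of_surjective (R := R ⧸ I) (S := R) Ideal.Quotient.mk_surjective]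
  exact Module.length_ne_top

end IsMultiplicitySystem

open Function in
/-- The multiplicity symbol is additive in short exact sequences. -/
lemma multiplicitySymbol_eq_add_of_exact [IsNoetherianRing R] (xs : List R) {N₁ N₂ N₃ : Type v}
    [AddCommGroup N₁] [Module R N₁] [AddCommGroup N₂] [Module R N₂] [AddCommGroup N₃] [Module R N₃]
    [Module.Finite R N₂] (h : IsMultiplicitySystem R xs N₂)
    (f : N₁ →ₗ[R] N₂) (g : N₂ →ₗ[R] N₃) (hf : Injective f) (hg : Surjective g)
    (hfg : Exact f g) :
    multiplicitySymbol xs N₂ = multiplicitySymbol xs N₁ + multiplicitySymbol xs N₃ := by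
  induction xs generalizing N₁ N₂ N₃ with
  | nil =>
    have : Module.Finite R N₁ := Module.Finite.of_injective f hf
    have : Module.Finite R N₃ := Module.Finite.of_surjective g hg
    simp only [multiplicitySymbol]
    rw [Module.length_eq_add_of_exact f g hf hg hfg,
      ENat.toNat_add (h.of_injective f hf).length_ne_top (h.of_surjective g hg).length_ne_top,
      Nat.cast_add]
  | cons x xs ih =>
    have : Module.Finite R N₁ := Module.Finite.of_injective f hf
    have : Module.Finite R N₃ := Module.Finite.of_surjective g hg
    obtain ⟨k₁, k₂, δ, c₁, c₂, hk₁, hk, hkδ, hδc, hc, hc₂⟩ :=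
      exists_quotSMulTop_torsionBy_exact x f g hf hg hfg
    have hN₁ := h.of_injective f hf
    have hN₃ := h.of_surjective g hg
    have split {A B C : Type v} [AddCommGroup A] [Module R A] [AddCommGroup B] [Module R B]
        [AddCommGroup C] [Module R C] [Module.Finite R B]
        (hB : IsMultiplicitySystem R xs B) (a : A →ₗ[R] B) (b : B →ₗ[R] C) (hab : Exact a b) :
        multiplicitySymbol xs B =
          multiplicitySymbol xs (LinearMap.range a) + multiplicitySymbol xs (LinearMap.range b) :=
      ih hB (LinearMap.range a).subtype b.rangeRestrict (Submodule.subtype_injective _)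
        b.surjective_rangeRestrict (by
          rw [LinearMap.exact_iff, LinearMap.ker_rangeRestrict, Submodule.range_subtype]
          exact hab.linearMap_ker_eq)
    have s₁ := ih h.torsionBy k₁ k₂.rangeRestrict hk₁ k₂.surjective_rangeRestrict (by
      rw [LinearMap.exact_iff, LinearMap.ker_rangeRestrict]; exact hk.linearMap_ker_eq)
    have s₂ := split hN₃.torsionBy k₂ δ hkδ
    have s₃ := split hN₁.quotSMulTop δ c₁ hδc
    have s₄ := ih h.quotSMulTop (LinearMap.range c₁).subtype c₂ (Submodule.subtype_injective _)
      hc₂ (by rw [LinearMap.exact_iff, Submodule.range_subtype]; exact hc.linearMap_ker_eq)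
    simp only [multiplicitySymbol]
    linarith

lemma multiplicitySymbol_congr [IsNoetherianRing R] {xs : List R} {N N' : Type v}
    [AddCommGroup N] [Module R N] [AddCommGroup N'] [Module R N'] [Module.Finite R N]
    (h : IsMultiplicitySystem R xs N) (e : N ≃ₗ[R] N') :
    multiplicitySymbol xs N = multiplicitySymbol xs N' := by
  have := multiplicitySymbol_eq_add_of_exact xs (N₁ := PUnit.{v + 1}) h 0 e.toLinearMap
    (Function.injective_of_subsingleton _) e.surjective
    (((e : N →ₗ[R] N').exact_zero_iff_injective _).mpr e.injective)
  rwa [multiplicitySymbol_of_subsingleton xs PUnit.{v + 1}, zero_add] at this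

/-- The multiplicity symbol vanishes on modules whose support has dimension smaller than the
number of elements. -/
lemma multiplicitySymbol_eq_zero [IsNoetherianRing R] (xs : List R) (N : Type v)
    [AddCommGroup N] [Module R N] [Module.Finite R N] (h : IsMultiplicitySystem R xs N)
    (hN : ∀ p ∈ Module.support R N, Order.coheight p < xs.length) :
    multiplicitySymbol xs N = 0 := by
  induction xs generalizing N with
  | nil =>
    have : Subsingleton N := by
      rw [← Module.support_eq_empty_iff (R := R), Set.eq_empty_iff_forall_notMem]
      intro p hp
      simpa using hN p hp
    exact multiplicitySymbol_of_subsingleton _ _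
  | cons x xs ih =>
    induction ‹Module.Finite R N› using
      IsNoetherianRing.induction_on_isQuotientEquivQuotientPrime R with
    | subsingleton N => exact multiplicitySymbol_of_subsingleton _ _
    | exact N₁ N₂ N₃ f g hf hg hfg h₁ h₃ =>
      rw [multiplicitySymbol_eq_add_of_exact _ h f g hf hg hfg,
        h₁ (h.of_injective f hf) fun p hp ↦ hN p (Module.support_subset_of_injective f hf hp),
        h₃ (h.of_surjective g hg) fun p hp ↦ hN p (Module.support_subset_of_surjective g hg hp),
        add_zero]
    | quotient N p e =>
      have hann : Module.annihilator R N = p.1 := by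
        rw [e.annihilator_eq, Ideal.annihilator_quotient]
      rw [multiplicitySymbol]
      by_cases hx : x ∈ p.1
      · have hx' : ∀ n : N, x • n = 0 := by
          rwa [← hann, Module.mem_annihilator] at hx
        have hquot : x • (⊤ : Submodule R N) = ⊥ := by
          rw [eq_bot_iff]
          intro n hn
          obtain ⟨m, -, rfl⟩ := (Submodule.mem_smul_pointwise_iff_exists _ _ _).mp hn
          exact hx' m
        have htors : Submodule.torsionBy R N x = ⊤ := by
          rw [eq_top_iff]
          exact fun n _ ↦ hx' n
        rw [multiplicitySymbol_congr h.quotSMulTop (Submodule.quotEquivOfEqBot _ hquot),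
          multiplicitySymbol_congr h.torsionBy (.ofTop _ htors), sub_self]
      · have htors : Subsingleton (Submodule.torsionBy R N x) := by
          rw [Submodule.subsingleton_iff_eq_bot, ← isSMulRegular_iff_torsionBy_eq_bot,
            e.isSMulRegular_congr, isSMulRegular_iff_right_eq_zero_of_smul]
          intro y hy
          rw [Algebra.smul_def, mul_eq_zero, Ideal.Quotient.algebraMap_eq,
            Ideal.Quotient.eq_zero_iff_mem] at hy
          exact hy.resolve_left hx
        rw [multiplicitySymbol_of_subsingleton (N := Submodule.torsionBy R N x), sub_zero]
        refine ih _ h.quotSMulTop fun q hq ↦ ?_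
        have hqp : q ∈ Module.support R N :=
          Module.support_subset_of_surjective _ (Submodule.mkQ_surjective _) hq
        have hpq : p < q := by
          refine lt_of_le_of_ne ?_ ?_
          · have := Module.annihilator_le_of_mem_support hqp
            rwa [hann] at this
          · rintro rfl
            exact hx (Module.annihilator_le_of_mem_support hq
              (QuotSMulTop.mem_annihilator _ x))
        have hp : p ∈ Module.support R N := by
          rw [Module.support_eq_zeroLocus, hann]
          exact (PrimeSpectrum.mem_zeroLocus _ _).mpr le_rfl
        have := (Order.coheight_add_one_le hpq).trans_lt (hN p hp)
        simpa using this

end MultiplicitySymbol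

section LocalLength

variable {R : Type u} [CommRing R]

/-- The length of the localization of a module at a prime (`0` if this is infinite). -/
noncomputable def localLength (p : PrimeSpectrum R) (N : Type v) [AddCommGroup N] [Module R N] :
    ℕ :=
  (Module.length (Localization.AtPrime p.1) (LocalizedModule p.1.primeCompl N)).toNat

variable {N N₁ N₂ N₃ : Type v} [AddCommGroup N] [Module R N] [AddCommGroup N₁] [Module R N₁]
  [AddCommGroup N₂] [Module R N₂] [AddCommGroup N₃] [Module R N₃] {p : PrimeSpectrum R}

lemma localLength_congr {N' : Type*} [AddCommGroup N'] [Module R N'] (e : N ≃ₗ[R] N') :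
    localLength p N = localLength p N' := by
  rw [localLength, localLength,
    (IsLocalizedModule.mapEquiv p.1.primeCompl (LocalizedModule.mkLinearMap p.1.primeCompl N)
      (LocalizedModule.mkLinearMap p.1.primeCompl N') (Localization.AtPrime p.1) e).length_eq]

lemma localLength_eq_zero (hp : p ∉ Module.support R N) : localLength p N = 0 := by
  rw [Module.notMem_support_iff] at hp
  simp [localLength]

variable [IsNoetherianRing R]

lemma length_localizedModule_ne_top (hp : p.1 ∈ minimalPrimes R) [Module.Finite R N] :
    Module.length (Localization.AtPrime p.1) (LocalizedModule p.1.primeCompl N) ≠ ⊤ := by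
  have : Ring.KrullDimLE 0 (Localization.AtPrime p.1) := .of_isLocalization _ hp _
  have : IsArtinianRing (Localization.AtPrime p.1) :=
    IsNoetherianRing.isArtinianRing_of_krullDimLE_zero
  exact Module.length_ne_top

lemma localLength_ne_zero (hp : p.1 ∈ minimalPrimes R) [Module.Finite R N]
    (hN : p ∈ Module.support R N) : localLength p N ≠ 0 := by
  rw [localLength, Ne, ENat.toNat_eq_zero, not_or]
  have := Module.mem_support_iff.mp hN
  exact ⟨Module.length_pos.ne', length_localizedModule_ne_top hp⟩

open Function in
lemma localLength_eq_add_of_exact (hp : p.1 ∈ minimalPrimes R) [Module.Finite R N₂]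
    (f : N₁ →ₗ[R] N₂) (g : N₂ →ₗ[R] N₃) (hf : Injective f) (hg : Surjective g)
    (hfg : Exact f g) :
    localLength p N₂ = localLength p N₁ + localLength p N₃ := by
  have : Module.Finite R N₁ := Module.Finite.of_injective f hf
  have : Module.Finite R N₃ := Module.Finite.of_surjective g hg
  rw [localLength, Module.length_eq_add_of_exact _ _
    (LocalizedModule.map_injective p.1.primeCompl f hf)
    (LocalizedModule.map_surjective p.1.primeCompl g hg)
    (LocalizedModule.map_exact p.1.primeCompl f g hfg),
    ENat.toNat_add (length_localizedModule_ne_top hp) (length_localizedModule_ne_top hp)]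
  rfl

/-- The associativity formula for multiplicities, with the weights left implicit. -/
lemma multiplicitySymbol_eq_sum_localLength [IsLocalRing R] {xs : List R}
    (h : IsMultiplicitySystem R xs R) (S : Finset (PrimeSpectrum R))
    (hS : ∀ p ∈ S, p.1 ∈ minimalPrimes R)
    (hS' : ∀ p ∉ S, Order.coheight p < xs.length)
    (N : Type u) [AddCommGroup N] [Module R N] [Module.Finite R N] :
    (multiplicitySymbol xs N : ℚ) = ∑ p ∈ S, localLength p N *
      ((multiplicitySymbol xs (R ⧸ p.1) : ℚ) / localLength p (R ⧸ p.1)) := by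
  have hsys (N : Type u) [AddCommGroup N] [Module R N] : IsMultiplicitySystem R xs N :=
    h.of_annihilator_le (by
      simp [Module.annihilator_eq_bot.mpr (inferInstance : FaithfulSMul R R)])
  induction ‹Module.Finite R N› using
    IsNoetherianRing.induction_on_isQuotientEquivQuotientPrime R with
  | subsingleton N =>
    rw [multiplicitySymbol_of_subsingleton, Finset.sum_eq_zero, Int.cast_zero]
    intro p _
    rw [localLength_eq_zero (by simp [Module.support_eq_empty]), Nat.cast_zero, zero_mul]
  | exact N₁ N₂ N₃ f g hf hg hfg h₁ h₃ =>
    rw [multiplicitySymbol_eq_add_of_exact xs (hsys N₂) f g hf hg hfg, Int.cast_add, h₁, h₃,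
      ← Finset.sum_add_distrib]
    refine Finset.sum_congr rfl fun p hp ↦ ?_
    rw [localLength_eq_add_of_exact (hS p hp) f g hf hg hfg, Nat.cast_add, add_mul]
  | quotient N q e =>
    have hsupp : Module.support R N = PrimeSpectrum.zeroLocus q.1 := by
      rw [Module.support_eq_zeroLocus, e.annihilator_eq, Ideal.annihilator_quotient]
    have hne {p : PrimeSpectrum R} (hp : p ∈ S) (hpq : p ≠ q) : localLength p N = 0 := by
      refine localLength_eq_zero fun hpN ↦ hpq ?_
      rw [hsupp, PrimeSpectrum.mem_zeroLocus] at hpN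
      exact PrimeSpectrum.ext (le_antisymm ((hS p hp).2 ⟨q.2, bot_le⟩ hpN) hpN)
    by_cases hq : q ∈ S
    · rw [Finset.sum_eq_single_of_mem q hq fun p hp hpq ↦ by
          rw [hne hp hpq, Nat.cast_zero, zero_mul],
        ← multiplicitySymbol_congr (hsys N) e, ← localLength_congr e, mul_div_cancel₀]
      have := localLength_ne_zero (N := N) (hS q hq) (by
        rw [hsupp]; exact (PrimeSpectrum.mem_zeroLocus _ _).mpr le_rfl)
      exact_mod_cast this
    · rw [Finset.sum_eq_zero fun p hp ↦ by
          rw [hne hp (ne_of_mem_of_not_mem hp hq), Nat.cast_zero, zero_mul],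
        multiplicitySymbol_eq_zero xs N (hsys N), Int.cast_zero]
      intro p hp
      rw [hsupp, PrimeSpectrum.mem_zeroLocus] at hp
      exact (Order.coheight_anti (show q ≤ p from hp)).trans_lt (hS' q hq)

end LocalLength

section RegularSequences

variable {R : Type u} [CommRing R]

open IsLocalRing RingTheory.Sequence

lemma multiplicitySymbol_eq_length_of_isWeaklyRegular {xs : List R} {M : Type v} [AddCommGroup M]
    [Module R M] (h : IsWeaklyRegular M xs) :
    multiplicitySymbol xs M =
      ((Module.length R (M ⧸ (Ideal.ofList xs • ⊤ : Submodule R M))).toNat : ℤ) := by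
  induction xs generalizing M with
  | nil =>
    have hbot : (Ideal.ofList ([] : List R) • ⊤ : Submodule R M) = ⊥ := by simp
    rw [multiplicitySymbol, (Submodule.quotEquivOfEqBot _ hbot).length_eq]
  | cons x xs ih =>
    rw [isWeaklyRegular_cons_iff] at h
    have : Subsingleton (Submodule.torsionBy R M x) := by
      rw [Submodule.subsingleton_iff_eq_bot, ← isSMulRegular_iff_torsionBy_eq_bot]
      exact h.1
    rw [multiplicitySymbol, multiplicitySymbol_of_subsingleton (N := Submodule.torsionBy R M x),
      sub_zero, ih h.2, (Submodule.quotOfListConsSMulTopEquivQuotSMulTopInner M x xs).length_eq]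

variable [IsNoetherianRing R] [IsLocalRing R]

lemma coheight_le_length_of_le_radical (p : PrimeSpectrum R) (xs : List R)
    (hxs : ∀ x ∈ xs, x ∈ maximalIdeal R)
    (h : maximalIdeal R ≤ (p.1 ⊔ Ideal.ofList xs).radical) :
    Order.coheight p ≤ xs.length := by
  classical
  let A := R ⧸ p.1
  have : Nontrivial A := Ideal.Quotient.nontrivial_iff.mpr p.2.ne_top
  have : IsLocalRing A := .of_surjective' (Ideal.Quotient.mk p.1) Ideal.Quotient.mk_surjective
  let s : Finset A := (xs.map (Ideal.Quotient.mk p.1)).toFinset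
  have hs : Ideal.span (s : Set A) = (Ideal.ofList xs).map (Ideal.Quotient.mk p.1) := by
    rw [Ideal.map_ofList]
    congr 1
    ext
    simp [s]
    rfl
  have hle : Ideal.span (s : Set A) ≤ maximalIdeal A := by
    rw [hs, Ideal.map_le_iff_le_comap, Ideal.span_le]
    intro x hx
    exact (Ideal.map_le_iff_le_comap.mp (((local_hom_TFAE (Ideal.Quotient.mk p.1)).out 0 2).mp
      (IsLocalHom.of_surjective _ Ideal.Quotient.mk_surjective))) (hxs x hx)
  have hmin : maximalIdeal A ∈ (Ideal.span (s : Set A)).minimalPrimes := by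
    refine ⟨⟨inferInstance, hle⟩, fun q ⟨hq, hqs⟩ _ ↦ ?_⟩
    have hcomap : maximalIdeal R ≤ q.comap (Ideal.Quotient.mk p.1) := by
      refine h.trans ((hq.comap _).radical_le_iff.mpr (sup_le ?_ ?_))
      · intro x hx
        rw [Ideal.mem_comap, Ideal.Quotient.eq_zero_iff_mem.mpr hx]
        exact q.zero_mem
      · rwa [← Ideal.map_le_iff_le_comap, ← hs]
    intro y hy
    obtain ⟨y, rfl⟩ := Ideal.Quotient.mk_surjective y
    refine hcomap ?_
    rw [IsLocalRing.mem_maximalIdeal, mem_nonunits_iff] at hy ⊢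
    exact fun hu ↦ hy (hu.map _)
  have hcard : s.card ≤ xs.length := (List.toFinset_card_le _).trans_eq (List.length_map ..)
  have hdim : (Order.coheight p : WithBot ℕ∞) = (maximalIdeal A).height := by
    rw [maximalIdeal_height_eq_ringKrullDim, ringKrullDim_quotient, Order.coheight_eq_krullDim_Ici]
    rfl
  rw [WithBot.coe_inj.mp hdim]
  exact (Ideal.height_le_card_of_mem_minimalPrimes_span_finset hmin).trans (by exact_mod_cast hcard)

open Submodule in
lemma length_le_coheight_of_isWeaklyRegular {xs : List R} {M : Type v} [AddCommGroup M] [Module R M]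
    [Module.Finite R M] (hxs : ∀ x ∈ xs, x ∈ maximalIdeal R) (h : IsWeaklyRegular M xs)
    (p : PrimeSpectrum R) (hp : p.1 ∈ associatedPrimes R M) :
    xs.length ≤ Order.coheight p := by
  induction xs generalizing M p with
  | nil => simp
  | cons x xs ih =>
    rw [isWeaklyRegular_cons_iff] at h
    rw [List.forall_mem_cons] at hxs
    have hreg := isSMulRegular_iff_right_eq_zero_of_smul.mp h.1
    obtain ⟨-, m, hm⟩ := isAssociatedPrime_iff.mp hp
    have hm' (a : R) : a ∈ p.1 ↔ a • m = 0 := by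
      rw [hm, mem_colon_singleton, mem_bot]
    have hm0 : m ≠ 0 := fun h0 ↦ p.2.ne_top
      ((Ideal.eq_top_iff_one _).mpr ((hm' 1).mpr (by rw [h0, smul_zero])))
    let K := torsionBySet R M p.1
    have hmK : m ∈ K := (mem_torsionBySet_iff _ _).mpr fun a ↦ (hm' a).mp a.2
    obtain ⟨n, hnK, hn⟩ : ∃ n ∈ K, n ∉ x • (⊤ : Submodule R M) := by
      by_contra! hK
      have hbot : K = ⊥ := by
        refine eq_bot_of_le_smul_of_le_jacobson_bot (Ideal.span {x}) K
          (IsNoetherian.noetherian K) (fun n hn ↦ ?_) ?_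
        · obtain ⟨n', -, rfl⟩ := (mem_smul_pointwise_iff_exists _ _ _).mp (hK n hn)
          refine smul_mem_smul (Ideal.mem_span_singleton_self x)
            ((mem_torsionBySet_iff _ _).mpr fun a ↦ hreg _ ?_)
          rw [smul_comm]
          exact (mem_torsionBySet_iff _ _).mp hn a
        · rw [IsLocalRing.jacobson_eq_maximalIdeal _ bot_ne_top, Ideal.span_singleton_le_iff_mem]
          exact hxs.1
      rw [hbot] at hmK
      exact hm0 hmK
    obtain ⟨Q, hQ, hle⟩ := exists_le_isAssociatedPrime_of_isNoetherianRing R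
      (Submodule.Quotient.mk n : QuotSMulTop x M) (by rwa [Ne, Submodule.Quotient.mk_eq_zero])
    have hpQ : p < ⟨Q, hQ.isPrime⟩ := by
      refine lt_of_le_of_ne (fun a ha ↦ hle ?_) ?_
      · rw [mem_colon_singleton, mem_bot, ← Submodule.Quotient.mk_smul,
          (mem_torsionBySet_iff _ _).mp hnK ⟨a, ha⟩, Submodule.Quotient.mk_zero]
      · rintro rfl
        refine hm0 (hreg _ ((hm' x).mp (hle ?_)))
        rw [mem_colon_singleton, mem_bot, ← Submodule.Quotient.mk_smul,
          Submodule.Quotient.mk_eq_zero]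
        exact smul_mem_pointwise_smul _ _ _ trivial
    calc ((x :: xs).length : ℕ∞) = xs.length + 1 := by simp
      _ ≤ Order.coheight (⟨Q, hQ.isPrime⟩ : PrimeSpectrum R) + 1 := by
        gcongr; exact ih hxs.2 h.2 _ hQ
      _ ≤ _ := Order.coheight_add_one_le hpQ

open CategoryTheory Abelian

lemma exists_isRegular_iff_subsingleton_ext {M : Type u} [AddCommGroup M] [Module R M]
    [Module.Finite R M] [Nontrivial M] (n : ℕ) :
    (∃ rs : List R, rs.length = n ∧ (∀ r ∈ rs, r ∈ maximalIdeal R) ∧ IsRegular M rs) ↔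
      ∀ i < n, Subsingleton
        (Ext (ModuleCat.of R (Shrink.{u} (R ⧸ maximalIdeal R))) (ModuleCat.of R M) i) :=
  ((ModuleCat.exists_isRegular_tfae (maximalIdeal R) n (ModuleCat.of R M)
    (Submodule.top_ne_ideal_smul_of_le_jacobson_annihilator
      (maximalIdeal_le_jacobson _)).symm.lt_top).out 1 3).symm

lemma exists_isRegular_quotSMulTop {M : Type u} [AddCommGroup M] [Module R M] [Module.Finite R M]
    {x : R} (hx : x ∈ maximalIdeal R) (hreg : IsSMulRegular M x) {rs : List R} {n : ℕ}
    (hrs : ∀ r ∈ rs, r ∈ maximalIdeal R) (h : IsRegular M rs) (hn : rs.length = n + 1) :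
    ∃ rs' : List R, rs'.length = n ∧ (∀ r ∈ rs', r ∈ maximalIdeal R) ∧
      IsRegular (QuotSMulTop x M) rs' := by
  have := h.nontrivial
  have := nontrivial_quotSMulTop_of_mem_maximalIdeal M hx
  have hM := (exists_isRegular_iff_subsingleton_ext (n + 1)).mp ⟨rs, hn, hrs, h⟩
  refine (exists_isRegular_iff_subsingleton_ext n).mpr fun i hi ↦ ?_
  have zero1 := AddCommGrpCat.isZero_of_iff_subsingleton.mpr (hM i (by omega))
  have zero2 := AddCommGrpCat.isZero_of_iff_subsingleton.mpr (hM (i + 1) (by omega))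
  exact AddCommGrpCat.subsingleton_of_isZero <| ShortComplex.Exact.isZero_of_both_zeros
    ((Ext.covariant_sequence_exact₃' _
      (IsSMulRegular.smulShortComplex_shortExact (M := ModuleCat.of R M) hreg)) i (i + 1) rfl)
    (zero1.eq_zero_of_src _) (zero2.eq_zero_of_tgt _)

/-- A system of parameters on a maximal Cohen–Macaulay module is a regular sequence. -/
lemma IsMultiplicitySystem.isWeaklyRegular {xs : List R} {M : Type u} [AddCommGroup M] [Module R M]
    [Module.Finite R M] (hM : IsMultiplicitySystem R xs M)
    (hxs : ∀ x ∈ xs, x ∈ maximalIdeal R) {rs : List R} (hrs : ∀ r ∈ rs, r ∈ maximalIdeal R)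
    (h : IsRegular M rs) (hlen : rs.length = xs.length) : IsWeaklyRegular M xs := by
  induction xs generalizing M rs with
  | nil => simp
  | cons x xs ih =>
    rw [List.forall_mem_cons] at hxs
    have hreg : IsSMulRegular M x := by
      by_contra hx
      have hx' : x ∈ ⋃ p ∈ associatedPrimes R M, (p : Set R) := by
        rw [biUnion_associatedPrimes_eq_compl_regular]; exact hx
      obtain ⟨P, hP, hxP⟩ := Set.mem_iUnion₂.mp hx'
      have hP : IsAssociatedPrime P M := hP
      have h₁ := length_le_coheight_of_isWeaklyRegular hrs h.1 ⟨P, hP.isPrime⟩ hP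
      have hle : Module.annihilator R M ⊔ Ideal.ofList (x :: xs) ≤ P ⊔ Ideal.ofList xs := by
        rw [Ideal.ofList_cons, ← sup_assoc, ← Submodule.annihilator_top]
        refine sup_le_sup_right (sup_le hP.annihilator_le ?_) _
        rwa [Ideal.span_singleton_le_iff_mem]
      have h₂ := coheight_le_length_of_le_radical ⟨P, hP.isPrime⟩ xs hxs.2
        (le_trans hM (Ideal.radical_mono hle))
      have := h₁.trans h₂
      rw [hlen, List.length_cons, Nat.cast_le] at this
      omega
    obtain ⟨rs', hlen', hrs', h'⟩ := exists_isRegular_quotSMulTop hxs.1 hreg hrs h hlen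
    exact .cons hreg (ih hM.quotSMulTop hxs.2 hrs' h' hlen')

end RegularSequences

section MaximalCohenMacaulay

open IsLocalRing RingTheory.Sequence

variable {R : Type u} [CommRing R]

lemma moduleLength_eq_length (M : Type v) [AddCommGroup M] [Module R M] :
    moduleLength R M = Module.length R M := by
  rw [← WithBot.coe_inj, Module.coe_length, Order.krullDim_eq_iSup_length]
  rfl

lemma length_localizedModule_of_free (P : Ideal R) [P.IsPrime] {M : Type v} [AddCommGroup M]
    [Module R M] [Module.Finite R M]
    [Module.Free (Localization.AtPrime P) (LocalizedModule P.primeCompl M)] :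
    Module.length (Localization.AtPrime P) (LocalizedModule P.primeCompl M) =
      Module.finrank (Localization.AtPrime P) (LocalizedModule P.primeCompl M) *
        Module.length (Localization.AtPrime P) (LocalizedModule P.primeCompl R) := by
  have e : Localization.AtPrime P ≃ₗ[Localization.AtPrime P] LocalizedModule P.primeCompl R :=
    (IsLocalizedModule.linearEquiv P.primeCompl (Algebra.linearMap R (Localization.AtPrime P))
      (LocalizedModule.mkLinearMap P.primeCompl R)).extendScalarsOfIsLocalization P.primeCompl _
  rw [← e.length_eq, Module.length_of_free_of_finite]

lemma localLength_eq_mul [IsNoetherianRing R] {r : ℕ} {M : Type v} [AddCommGroup M] [Module R M]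
    [Module.Finite R M]
    (hfree : ∀ (P : Ideal R) [P.IsPrime], P ∈ associatedPrimes R R →
      Module.Free (Localization.AtPrime P) (LocalizedModule P.primeCompl M) ∧
        Module.finrank (Localization.AtPrime P) (LocalizedModule P.primeCompl M) = r)
    {p : PrimeSpectrum R} (hp : p.1 ∈ minimalPrimes R) :
    localLength p M = r * localLength p R := by
  have hass : p.1 ∈ associatedPrimes R R := by
    apply Module.associatedPrimes.minimalPrimes_annihilator_subset_associatedPrimes
    rwa [Module.annihilator_eq_bot.mpr inferInstance]
  obtain ⟨_, hr⟩ := hfree p.1 hass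
  rw [localLength, length_localizedModule_of_free, hr, ENat.toNat_mul, ENat.toNat_natCast]
  rfl

variable [IsLocalRing R]

lemma moduleDepth_congr {M : Type v} [AddCommGroup M] [Module R M] {N : Type*} [AddCommGroup N]
    [Module R N] (e : M ≃ₗ[R] N) : moduleDepth R M = moduleDepth R N := by
  simp only [moduleDepth, e.isWeaklyRegular_congr]

lemma exists_isWeaklyRegular_of_moduleDepth_eq {M : Type v} [AddCommGroup M] [Module R M] {d : ℕ}
    (h : moduleDepth R M = d) :
    ∃ rs : List R, (∀ r ∈ rs, r ∈ maximalIdeal R) ∧ IsWeaklyRegular M rs ∧ rs.length = d := by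
  obtain rfl | hd := Nat.eq_zero_or_pos d
  · exact ⟨[], by simp, .nil R M, rfl⟩
  obtain ⟨_, ⟨rs, hrs, hreg, rfl⟩, hlt⟩ := lt_sSup_iff.mp
    (h.symm ▸ Nat.cast_lt.mpr (Nat.sub_one_lt_of_lt hd) : ((d - 1 : ℕ) : ℕ∞) < moduleDepth R M)
  have hle : (rs.length : ℕ∞) ≤ d := h ▸ le_sSup ⟨rs, hrs, hreg, rfl⟩
  norm_cast at hlt hle
  exact ⟨rs, hrs, hreg, by lia⟩

lemma maximalIdeal_le_radical_of_length_ne_top {q : Ideal R}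
    (h : Module.length R (R ⧸ q) ≠ ⊤) : maximalIdeal R ≤ q.radical := by
  have := (isFiniteLength_iff_isNoetherian_isArtinian.mp (Module.length_ne_top_iff.mp h)).2
  have : IsArtinianRing (R ⧸ q) := isArtinian_of_tower R this
  rw [Ideal.radical_eq_sInf]
  refine le_sInf fun p ⟨hqp, hp⟩ ↦ ?_
  have := Ideal.map_isPrime_of_surjective (f := Ideal.Quotient.mk q) Ideal.Quotient.mk_surjective
    (I := p) (by rwa [Ideal.mk_ker])
  have := (IsArtinianRing.isPrime_iff_isMaximal _).mp this
  have := Ideal.comap_isMaximal_of_surjective (Ideal.Quotient.mk q) Ideal.Quotient.mk_surjective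
    (K := p.map (Ideal.Quotient.mk q))
  rw [Ideal.comap_map_of_surjective' _ Ideal.Quotient.mk_surjective, Ideal.mk_ker,
    sup_eq_left.mpr hqp] at this
  exact (eq_maximalIdeal this).ge

lemma spanFinrank_top_le_length_quotient {q : Ideal R} (hq : q ≤ maximalIdeal R) {M : Type v}
    [AddCommGroup M] [Module R M] [Module.Finite R M] :
    ((⊤ : Submodule R M).spanFinrank : ℕ∞) ≤ Module.length R (M ⧸ (q • ⊤ : Submodule R M)) := by
  let := Ideal.Quotient.field (maximalIdeal R)
  let T := (⊤ : Submodule R M)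
  rw [spanFinrank_eq_finrank_quotient T Module.Finite.fg_top, ← Module.length_eq_finrank,
    ← Module.length_eq_of_surjective (S := R) Ideal.Quotient.mk_surjective]
  let e : T ≃ₗ[R] M := Submodule.topEquiv
  have hle : (q • ⊤ : Submodule R M) ≤
      (maximalIdeal R • (⊤ : Submodule R T)).comap e.symm.toLinearMap := by
    rw [← Submodule.map_le_iff_le_comap, Submodule.map_smul'']
    exact Submodule.smul_mono hq le_top
  exact Module.length_le_of_surjective (Submodule.mapQ _ _ e.symm.toLinearMap hle) (by
    rw [← LinearMap.range_eq_top, Submodule.range_mapQ, LinearEquiv.range, Submodule.map_top,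
      Submodule.range_mkQ])

variable [IsNoetherianRing R]

lemma multiplicitySymbol_eq_mul {xs : List R} (h : IsMultiplicitySystem R xs R)
    (hdim : ringKrullDim R = xs.length) {r : ℕ} {M : Type u} [AddCommGroup M] [Module R M]
    [Module.Finite R M]
    (hM : ∀ p : PrimeSpectrum R, p.1 ∈ minimalPrimes R → localLength p M = r * localLength p R) :
    multiplicitySymbol xs M = r * multiplicitySymbol xs R := by
  have hfin : {p : PrimeSpectrum R | p.1 ∈ minimalPrimes R}.Finite :=
    (minimalPrimes.finite_of_isNoetherianRing R).preimage
      fun p _ p' _ ↦ PrimeSpectrum.ext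
  have hS : ∀ p ∈ hfin.toFinset, p.1 ∈ minimalPrimes R := by simp
  have hS' : ∀ p ∉ hfin.toFinset, Order.coheight p < xs.length := by
    intro p hp
    obtain ⟨P, hP, hle⟩ := Ideal.exists_minimalPrimes_le (bot_le (a := p.1))
    have hlt : (⟨P, hP.1.1⟩ : PrimeSpectrum R) < p :=
      lt_of_le_of_ne hle fun hPp ↦ hp (by simpa [← hPp] using hP)
    have hle : Order.coheight p + 1 ≤ xs.length := by
      refine (Order.coheight_add_one_le hlt).trans ?_
      have := Order.coheight_le_krullDim (⟨P, hP.1.1⟩ : PrimeSpectrum R)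
      rw [← ringKrullDim, hdim] at this
      exact_mod_cast this
    exact (ENat.add_one_le_iff (ne_top_of_le_ne_top (ENat.natCast_ne_top _)
      (le_self_add.trans hle))).mp hle
  have : (multiplicitySymbol xs M : ℚ) = r * multiplicitySymbol xs R := by
    rw [multiplicitySymbol_eq_sum_localLength h _ hS hS',
      multiplicitySymbol_eq_sum_localLength h _ hS hS', Finset.mul_sum]
    refine Finset.sum_congr rfl fun p hp ↦ ?_
    rw [hM p (hS p hp), Nat.cast_mul, mul_assoc]
  exact_mod_cast this

/-- A maximal Cohen–Macaulay module of rank `r` satisfies `ℓ(M ⧸ qM) = r ℓ(R ⧸ q)` for every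
parameter ideal `q`. -/
lemma length_quotient_eq_mul {xs : List R} (hxs : ∀ x ∈ xs, x ∈ maximalIdeal R)
    (hdim : ringKrullDim R = xs.length) (hlen : Module.length R (R ⧸ Ideal.ofList xs) ≠ ⊤)
    (hR : moduleDepth R R = xs.length) {M : Type u} [AddCommGroup M] [Module R M]
    [Module.Finite R M] [Nontrivial M] (hM : moduleDepth R M = xs.length) {r : ℕ}
    (hr : ∀ p : PrimeSpectrum R, p.1 ∈ minimalPrimes R → localLength p M = r * localLength p R) :
    Module.length R (M ⧸ (Ideal.ofList xs • ⊤ : Submodule R M)) =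
      r * Module.length R (R ⧸ Ideal.ofList xs) := by
  have hsys (N : Type u) [AddCommGroup N] [Module R N] : IsMultiplicitySystem R xs N :=
    (maximalIdeal_le_radical_of_length_ne_top hlen).trans (Ideal.radical_mono le_sup_right)
  have key (N : Type u) [AddCommGroup N] [Module R N] [Module.Finite R N] [Nontrivial N]
      (hN : moduleDepth R N = xs.length) : multiplicitySymbol xs N =
        ((Module.length R (N ⧸ (Ideal.ofList xs • ⊤ : Submodule R N))).toNat : ℤ) := by
    obtain ⟨rs, hrs, hreg, hrslen⟩ := exists_isWeaklyRegular_of_moduleDepth_eq hN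
    exact multiplicitySymbol_eq_length_of_isWeaklyRegular
      ((hsys N).isWeaklyRegular hxs hrs (.of_isWeaklyRegular_of_mem_maximalIdeal _ hrs hreg) hrslen)
  have hne : Module.length R (M ⧸ (Ideal.ofList xs • ⊤ : Submodule R M)) ≠ ⊤ := by
    refine IsMultiplicitySystem.length_ne_top ?_
    refine (maximalIdeal_le_radical_of_length_ne_top hlen).trans
      (Ideal.radical_mono (le_sup_of_le_left fun a ha ↦ ?_))
    rw [Module.mem_annihilator]
    intro m
    obtain ⟨m, rfl⟩ := Submodule.mkQ_surjective _ m
    rw [← map_smul, Submodule.mkQ_apply, Submodule.Quotient.mk_eq_zero]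
    exact Submodule.smul_mem_smul ha trivial
  have := multiplicitySymbol_eq_mul (hsys R) hdim hr
  rw [key M hM, key R hR, smul_eq_mul, Ideal.mul_top] at this
  rw [← ENat.natCast_toNat hne, ← ENat.natCast_toNat hlen]
  exact_mod_cast this

end MaximalCohenMacaulay

/-- **Corollary 6.** Let `R` be a commutative Noetherian local Cohen–Macaulay ring
(`depth R = dim R`), `q` a parameter ideal of `R` (generated by `dim R` elements of the
maximal ideal) and `t = ℓ(R/q)`.  Let `M` be a finitely generated maximal Cohen–Macaulay
`R`-module (`depth M = dim R`) such that `M_P` is a free `R_P`-module of constant rank `r`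
for every associated prime `P` of `R`.  Then `μ(M) ≤ r·t`. -/
theorem generators_bound_of_maximal_cohenMacaulay
    {R : Type*} [CommRing R] [IsNoetherianRing R] [IsLocalRing R]
    (hCMR : (moduleDepth R R : WithBot ℕ∞) = ringKrullDim R)
    (d : ℕ) (hd : ringKrullDim R = d)
    (q : Ideal R) (f : Fin d → R) (hfm : ∀ i, f i ∈ IsLocalRing.maximalIdeal R)
    (hq : q = Ideal.span (Set.range f))
    (t : ℕ) (ht : moduleLength R (R ⧸ q) = t)
    (M : Type*) [AddCommGroup M] [Module R M] [Module.Finite R M]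
    (hMCM : (moduleDepth R M : WithBot ℕ∞) = ringKrullDim R)
    (r : ℕ)
    (hfree : ∀ (P : Ideal R) [P.IsPrime], P ∈ associatedPrimes R R →
      Module.Free (Localization.AtPrime P) (LocalizedModule P.primeCompl M) ∧
        Module.finrank (Localization.AtPrime P) (LocalizedModule P.primeCompl M) = r) :
    ∃ s : Finset M, s.card ≤ r * t ∧ Submodule.span R (s : Set M) = ⊤ := by
  have hle : q ≤ IsLocalRing.maximalIdeal R := by
    rw [hq, Ideal.span_le, Set.range_subset_iff]
    exact hfm
  have hqf : Ideal.ofList (List.ofFn f) = q := by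
    rw [hq, Ideal.ofList]
    congr 1
    ext
    simp
  rw [moduleLength_eq_length] at ht
  rw [hd, ← WithBot.coe_natCast, WithBot.coe_inj] at hCMR hMCM
  suffices (⊤ : Submodule R M).spanFinrank ≤ r * t by
    obtain ⟨s, hs, hspan⟩ :=
      (Module.Finite.fg_top (R := R) (M := M)).exists_span_finset_card_eq_spanFinrank
    exact ⟨s, hs.trans_le this, hspan⟩
  cases subsingleton_or_nontrivial M
  · simp [Subsingleton.elim (⊤ : Submodule R M) ⊥]
  have := Module.Finite.small R M
  let e := Shrink.linearEquiv R M
  have : Module.Finite R (Shrink M) := .equiv e.symm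
  have key := length_quotient_eq_mul (xs := List.ofFn f) (M := Shrink M) (r := r)
    (by simpa using hfm) (by simpa using hd) (by rw [hqf, ht]; exact ENat.natCast_ne_top t)
    (by simpa using hCMR) (by simpa [moduleDepth_congr e] using hMCM)
    fun p hp ↦ by rw [localLength_congr e, localLength_eq_mul hfree hp]
  have := spanFinrank_top_le_length_quotient hle (M := Shrink M)
  rw [← hqf, key, hqf, ht] at this
  rw [← LinearEquiv.range e, ← Submodule.map_top,
    Submodule.spanFinrank_map_eq_of_injective _ e.injective]
  exact_mod_cast this
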